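/- Let γ ∈ (1/2, 1). There exists a constant C > 0, depending only on γ, such that for every u ∈ C¹([0,1]) with u(0) = u(1) = 0, one has |u|²_{H^γ(0,1)} ≤ C·| ∫₀¹ (₀D_x^γ u)(x) · (ₓD₁^γ u)(x) dx |. -/

import Mathlib

open MeasureTheory Set intervalIntegral

/-- Left Riemann–Liouville derivative of order `γ ∈ (0,1)` based at `0`:
`(₀D_x^γ u)(x) = (1/Γ(1-γ)) d/dx ∫₀ˣ (x-t)^{-γ} u(t) dt`. -/
noncomputable def rlLeft (γ : ℝ) (u : ℝ → ℝ) : ℝ → ℝ :=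
  deriv (fun x => (1 / Real.Gamma (1 - γ)) * ∫ t in (0:ℝ)..x, (x - t) ^ (-γ) * u t)

/-- Right Riemann–Liouville derivative of order `γ ∈ (0,1)` based at `1`:
`(ₓD₁^γ u)(x) = -(1/Γ(1-γ)) d/dx ∫ₓ¹ (t-x)^{-γ} u(t) dt`. -/
noncomputable def rlRight (γ : ℝ) (u : ℝ → ℝ) : ℝ → ℝ :=
  deriv (fun x => -(1 / Real.Gamma (1 - γ)) * ∫ t in x..(1:ℝ), (t - x) ^ (-γ) * u t)

/-- The truncated power `r ↦ r₊ᵃ`, equal to `rᵃ` for `0 < r` and to `0` otherwise. -/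
noncomputable def posPow (a r : ℝ) : ℝ :=
  (Ioi (0 : ℝ)).indicator (fun r => r ^ a) r

lemma posPow_of_pos {a r : ℝ} (hr : 0 < r) : posPow a r = r ^ a :=
  indicator_of_mem (mem_Ioi.2 hr) _

lemma posPow_of_nonpos {a r : ℝ} (hr : r ≤ 0) : posPow a r = 0 :=
  indicator_of_notMem (notMem_Ioi.2 hr) _

lemma posPow_nonneg (a r : ℝ) : 0 ≤ posPow a r :=
  indicator_nonneg (fun _ hr => Real.rpow_nonneg (le_of_lt hr) _) _

@[fun_prop]
lemma measurable_posPow (a : ℝ) : Measurable (posPow a) :=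
  (measurable_id.pow_const a).indicator measurableSet_Ioi

lemma posPow_mul {a d z : ℝ} (hd : 0 < d) : posPow a (d * z) = d ^ a * posPow a z := by
  rcases le_or_gt z 0 with hz | hz
  · rw [posPow_of_nonpos hz, posPow_of_nonpos (mul_nonpos_of_nonneg_of_nonpos hd.le hz), mul_zero]
  · rw [posPow_of_pos hz, posPow_of_pos (mul_pos hd hz), Real.mul_rpow hd.le hz.le]

lemma integrable_posPow_tail {a c : ℝ} (ha : a < -1) (hc : 0 < c) :
    Integrable ((Ioi c).indicator (posPow a)) ∧
      ∫ r, (Ioi c).indicator (posPow a) r = c ^ (a + 1) / (-(a + 1)) := by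
  have h : EqOn (posPow a) (fun r => r ^ a) (Ioi c) := fun r hr => posPow_of_pos (hc.trans hr)
  rw [integrable_indicator_iff measurableSet_Ioi, MeasureTheory.integral_indicator measurableSet_Ioi,
    integrableOn_congr_fun h measurableSet_Ioi, setIntegral_congr_fun measurableSet_Ioi h,
    integral_Ioi_rpow_of_lt ha hc]
  exact ⟨integrableOn_Ioi_rpow_of_lt ha hc, by rw [div_neg, neg_div]⟩

lemma integrable_posPow_head {a : ℝ} (ha : -1 < a) (c : ℝ) :
    Integrable ((Ioc 0 c).indicator (posPow a)) ∧
      ∫ r, (Ioc 0 c).indicator (posPow a) r = posPow (a + 1) c / (a + 1) := by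
  rcases le_or_gt c 0 with hc | hc
  · simp [Ioc_eq_empty_of_le hc, posPow_of_nonpos hc]
  have h : EqOn (posPow a) (fun r => r ^ a) (Ioc 0 c) := fun r hr => posPow_of_pos hr.1
  rw [integrable_indicator_iff measurableSet_Ioc, MeasureTheory.integral_indicator measurableSet_Ioc,
    integrableOn_congr_fun h measurableSet_Ioc, setIntegral_congr_fun measurableSet_Ioc h,
    ← intervalIntegral.integral_of_le hc.le, integral_rpow (Or.inl ha), posPow_of_pos hc,
    Real.zero_rpow (by linarith), sub_zero]
  exact ⟨(intervalIntegrable_iff_integrableOn_Ioc_of_le hc.le).1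
    (intervalIntegral.intervalIntegrable_rpow' ha), rfl⟩

/-- Fubini for a weighted nonnegative kernel whose partial integrals are known. -/
lemma integral_weight_mul_kernel {α β : Type*} [MeasurableSpace α] [MeasurableSpace β]
    {μ : Measure α} {ν : Measure β} [SFinite μ] [SFinite ν]
    {w ρ : α → ℝ} {κ : α → β → ℝ} (hw : Measurable w) (hκm : Measurable (Function.uncurry κ))
    (hκ : ∀ a b, 0 ≤ κ a b) (hρ : Integrable (fun a => w a * ρ a) μ)
    (h : ∀ a, w a ≠ 0 → Integrable (κ a) ν ∧ ∫ b, κ a b ∂ν = ρ a) :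
    Integrable (fun z : α × β => w z.1 * κ z.1 z.2) (μ.prod ν) ∧
      ∫ b, ∫ a, w a * κ a b ∂μ ∂ν = ∫ a, w a * ρ a ∂μ := by
  have hint : Integrable (fun z : α × β => w z.1 * κ z.1 z.2) (μ.prod ν) := by
    have hm : Measurable (fun z : α × β => w z.1 * κ z.1 z.2) :=
      (hw.comp measurable_fst).mul hκm
    refine (integrable_prod_iff hm.aestronglyMeasurable).2 ⟨.of_forall fun a => ?_, ?_⟩
    · by_cases ha : w a = 0
      · simp [ha]
      · exact (h a ha).1.const_mul (w a)
    · refine hρ.norm.congr (.of_forall fun a => ?_)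
      by_cases ha : w a = 0
      · simp [ha]
      · have h0 : 0 ≤ ρ a := (h a ha).2 ▸ integral_nonneg (hκ a)
        simp only [norm_mul, MeasureTheory.integral_const_mul, Real.norm_of_nonneg (hκ a _), (h a ha).2,
          Real.norm_of_nonneg h0]
  refine ⟨hint, ?_⟩
  rw [← integral_integral_swap hint]
  refine integral_congr_ae (.of_forall fun a => ?_)
  by_cases ha : w a = 0
  · simp [ha]
  · simp only [MeasureTheory.integral_const_mul, (h a ha).2]

lemma two_mul_integral_mul_of_lt {f : ℝ → ℝ} (hf : Integrable f) :
    2 * ∫ p : ℝ × ℝ, {p : ℝ × ℝ | p.1 < p.2}.indicator (fun p => f p.1 * f p.2) p =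
      (∫ s, f s) ^ 2 := by
  have hF : Integrable (fun p : ℝ × ℝ => f p.1 * f p.2) := hf.mul_prod hf
  have hlt : MeasurableSet {p : ℝ × ℝ | p.1 < p.2} := measurableSet_lt measurable_fst measurable_snd
  have hle : {p : ℝ × ℝ | p.1 < p.2}ᶜ = {p : ℝ × ℝ | p.2 ≤ p.1} := by ext; simp
  have hswap : ∫ p in {p : ℝ × ℝ | p.2 ≤ p.1}, f p.1 * f p.2 =
      ∫ p in {p : ℝ × ℝ | p.1 ≤ p.2}, f p.1 * f p.2 := by
    have := (Measure.measurePreserving_swap (μ := (volume : Measure ℝ))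
      (ν := (volume : Measure ℝ))).setIntegral_preimage_emb
      MeasurableEquiv.prodComm.measurableEmbedding (fun p => f p.1 * f p.2) {p | p.1 ≤ p.2}
    rw [← Measure.volume_eq_prod] at this
    rw [← this]
    simp [mul_comm]
  have hae : {p : ℝ × ℝ | p.1 ≤ p.2} =ᵐ[volume] {p : ℝ × ℝ | p.1 < p.2} := by
    have h0 : volume {p : ℝ × ℝ | p.1 = p.2} = 0 := by
      rw [Measure.volume_eq_prod,
        Measure.measure_prod_null (measurableSet_eq_fun measurable_fst measurable_snd)]
      refine .of_forall fun x => ?_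
      simp [preimage]
    filter_upwards [measure_eq_zero_iff_ae_notMem.1 h0] with p hp
    refine propext ⟨fun h => lt_of_le_of_ne h hp, fun h => le_of_lt h⟩
  rw [MeasureTheory.integral_indicator hlt]
  have hsum := integral_add_compl hlt hF
  rw [hle, hswap, setIntegral_congr_set hae] at hsum
  rw [two_mul, hsum, sq, Measure.volume_eq_prod, integral_prod_mul]

lemma integrable_slab_kernel {a s t : ℝ} (ha : a < -2) (hst : s < t) :
    Integrable (fun q : ℝ × ℝ => if q.1 < s ∧ t < q.2 then posPow a (q.2 - q.1) else 0) ∧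
      ∫ q : ℝ × ℝ, (if q.1 < s ∧ t < q.2 then posPow a (q.2 - q.1) else 0) =
        (t - s) ^ (a + 2) / ((a + 1) * (a + 2)) := by
  have hx : (fun x => (Iio s).indicator (1 : ℝ → ℝ) x * (posPow (a + 1) (t - x) / (-(a + 1)))) =
      fun x => (Ioi (t - s)).indicator (posPow (a + 1)) (t - x) / (-(a + 1)) := by
    ext x
    by_cases h : x < s <;> simp [indicator, h]
  obtain ⟨h1, h2⟩ := integrable_posPow_tail (a := a + 1) (by linarith) (sub_pos.2 hst)
  obtain ⟨hI, hE⟩ := integral_weight_mul_kernel (μ := (volume : Measure ℝ))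
    (ν := (volume : Measure ℝ)) (w := (Iio s).indicator 1)
    (ρ := fun x => posPow (a + 1) (t - x) / (-(a + 1)))
    (κ := fun x y => (Ioi (t - x)).indicator (posPow a) (y - x))
    (measurable_one.indicator measurableSet_Iio)
    (by
      have : (Function.uncurry fun x y => (Ioi (t - x)).indicator (posPow a) (y - x)) =
          fun q : ℝ × ℝ => if t < q.2 then posPow a (q.2 - q.1) else 0 := by
        ext q
        simp [Function.uncurry, indicator]
      rw [this]
      exact Measurable.ite (measurableSet_lt measurable_const measurable_snd) (by fun_prop)
        measurable_const)
    (fun x y => indicator_nonneg (fun _ _ => posPow_nonneg _ _) _)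
    (by rw [hx]; exact (h1.comp_sub_left t).div_const _)
    (fun x hxs => by
      have hxs : x < s := by
        by_contra h
        exact hxs (indicator_of_notMem (by simpa using h) _)
      obtain ⟨h3, h4⟩ := integrable_posPow_tail (a := a) (c := t - x) (by linarith) (by linarith)
      refine ⟨h3.comp_sub_right x, ?_⟩
      rw [integral_sub_right_eq_self ((Ioi (t - x)).indicator (posPow a)), h4,
        posPow_of_pos (by linarith)])
  have hq : (fun z : ℝ × ℝ => (Iio s).indicator (1 : ℝ → ℝ) z.1 *
      (Ioi (t - z.1)).indicator (posPow a) (z.2 - z.1)) =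
      fun q : ℝ × ℝ => if q.1 < s ∧ t < q.2 then posPow a (q.2 - q.1) else 0 := by
    ext q
    by_cases h : q.1 < s <;> simp [indicator, h]
  rw [← hq]
  refine ⟨hI, ?_⟩
  rw [Measure.volume_eq_prod, integral_prod_symm _ hI, hE, hx, MeasureTheory.integral_div,
    integral_sub_left_eq_self ((Ioi (t - s)).indicator (posPow (a + 1))), h2, div_div]
  ring_nf

/-- Bounded measurable functions vanishing outside `(0, 1)`. -/
structure BoundedOnUnit (g : ℝ → ℝ) : Prop where
  measurable : Measurable g
  eq_zero : ∀ x, x ∉ Ioo (0 : ℝ) 1 → g x = 0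
  bounded : ∃ M, ∀ x, ‖g x‖ ≤ M

namespace BoundedOnUnit

variable {g : ℝ → ℝ}

lemma mem_of_ne (hg : BoundedOnUnit g) {x : ℝ} (h : g x ≠ 0) : x ∈ Ioo (0 : ℝ) 1 := by
  by_contra hx
  exact h (hg.eq_zero x hx)

lemma integrable_mul (hg : BoundedOnUnit g) {f : ℝ → ℝ} (hf : IntegrableOn f (Ioo 0 1)) :
    Integrable (fun x => g x * f x) := by
  obtain ⟨M, hM⟩ := hg.bounded
  have h := ((integrable_indicator_iff measurableSet_Ioo).2 hf).bdd_mul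
    hg.measurable.aestronglyMeasurable (.of_forall hM)
  refine h.congr (.of_forall fun x => ?_)
  by_cases hx : x ∈ Ioo (0 : ℝ) 1
  · simp [hx]
  · simp [hg.eq_zero x hx]

lemma integrable (hg : BoundedOnUnit g) : Integrable g := by
  simpa using hg.integrable_mul (f := fun _ => 1) (integrableOn_const (by simp))

lemma integrable_mul_mul_posPow (hg : BoundedOnUnit g) {a : ℝ} (ha : -1 < a) :
    Integrable (fun p : ℝ × ℝ => g p.1 * g p.2 * posPow a (p.2 - p.1)) := by
  obtain ⟨h1, -⟩ := integrable_posPow_head ha 1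
  have h := (integral_weight_mul_kernel (μ := (volume : Measure ℝ))
    (ν := (volume : Measure ℝ)) (w := g)
    (ρ := fun _ => ∫ r, (Ioc 0 1).indicator (posPow a) r)
    (κ := fun s t => (Ioc 0 1).indicator (posPow a) (t - s)) hg.measurable
    (((measurable_posPow a).indicator measurableSet_Ioc).comp
      (measurable_snd.sub measurable_fst))
    (fun x y => indicator_nonneg (fun _ _ => posPow_nonneg _ _) _)
    (hg.integrable.mul_const _)
    (fun s _ => ⟨h1.comp_sub_right s, integral_sub_right_eq_self _ s⟩)).1
  obtain ⟨M, hM⟩ := hg.bounded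
  refine (h.bdd_mul (f := fun p : ℝ × ℝ => g p.2)
    (hg.measurable.comp measurable_snd).aestronglyMeasurable
    (.of_forall fun p => hM p.2)).congr (.of_forall fun p => ?_)
  by_cases h1 : g p.1 = 0
  · simp [h1]
  by_cases h2 : g p.2 = 0
  · simp [h2]
  have h1 := hg.mem_of_ne h1
  have h2 := hg.mem_of_ne h2
  have h3 : (Ioc 0 1).indicator (posPow a) (p.2 - p.1) = posPow a (p.2 - p.1) := by
    rcases le_or_gt (p.2 - p.1) 0 with h | h
    · rw [posPow_of_nonpos h, indicator_of_notMem fun h' => absurd h'.1 (not_lt.2 h)]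
    · exact indicator_of_mem (mem_Ioc.2 ⟨h, by linarith [h1.1, h2.2]⟩) _
  simp only [h3]
  ring

end BoundedOnUnit

/-- The integrand of the Euler beta integral `B(1 - γ, 1 - γ)`, extended by zero. -/
noncomputable def betaKernel (γ z : ℝ) : ℝ := posPow (-γ) z * posPow (-γ) (1 - z)

lemma betaKernel_nonneg (γ z : ℝ) : 0 ≤ betaKernel γ z :=
  mul_nonneg (posPow_nonneg _ _) (posPow_nonneg _ _)

lemma integrable_betaKernel {γ : ℝ} (hγ : γ < 1) : Integrable (betaKernel γ) := by
  have h := (Complex.betaIntegral_convergent (u := ((1 - γ : ℝ) : ℂ)) (v := ((1 - γ : ℝ) : ℂ))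
    (by simpa using hγ) (by simpa using hγ)).norm
  rw [intervalIntegrable_iff_integrableOn_Ioo_of_le zero_le_one] at h
  have h' : IntegrableOn (betaKernel γ) (Ioo 0 1) := by
    refine h.congr_fun (fun x hx => ?_) measurableSet_Ioo
    have h1 : (1 - (x : ℂ)) = ((1 - x : ℝ) : ℂ) := by push_cast; rfl
    simp only [betaKernel, norm_mul, h1]
    rw [posPow_of_pos hx.1, posPow_of_pos (sub_pos.2 hx.2),
      Complex.norm_cpow_eq_rpow_re_of_pos hx.1,
      Complex.norm_cpow_eq_rpow_re_of_pos (sub_pos.2 hx.2)]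
    simp
  refine h'.integrable_of_forall_notMem_eq_zero fun x hx => ?_
  rcases le_or_gt x 0 with h0 | h0
  · simp [betaKernel, posPow_of_nonpos h0]
  · have h1 : 1 - x ≤ 0 := by
      by_contra h1
      exact hx ⟨h0, by linarith⟩
    simp [betaKernel, posPow_of_nonpos h1]

lemma integral_betaKernel_pos {γ : ℝ} (hγ : γ < 1) : 0 < ∫ z, betaKernel γ z := by
  rw [integral_pos_iff_support_of_nonneg (betaKernel_nonneg γ) (integrable_betaKernel hγ)]
  refine lt_of_lt_of_le (b := volume (Ioo (0 : ℝ) 1)) (by simp) (measure_mono fun z hz => ?_)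
  rw [Function.mem_support, betaKernel, posPow_of_pos hz.1, posPow_of_pos (sub_pos.2 hz.2)]
  exact (mul_pos (Real.rpow_pos_of_pos hz.1 _) (Real.rpow_pos_of_pos (sub_pos.2 hz.2) _)).ne'

lemma integrable_posPow_mul_posPow {γ : ℝ} (hγ : γ < 1) (s t : ℝ) :
    Integrable (fun x => posPow (-γ) (x - s) * posPow (-γ) (t - x)) ∧
      ∫ x, posPow (-γ) (x - s) * posPow (-γ) (t - x) =
        (∫ z, betaKernel γ z) * posPow (1 - 2 * γ) (t - s) := by
  rcases le_or_gt (t - s) 0 with hst | hst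
  · have h0 : (fun x => posPow (-γ) (x - s) * posPow (-γ) (t - x)) = fun _ => 0 := by
      ext x
      rcases le_or_gt (x - s) 0 with h | h
      · rw [posPow_of_nonpos h, zero_mul]
      · rw [posPow_of_nonpos (a := -γ) (r := t - x) (by linarith), mul_zero]
    simp [h0, posPow_of_nonpos hst]
  · set d := t - s with hd
    have hφ : (fun x => posPow (-γ) (x - s) * posPow (-γ) (t - x)) =
        fun x => d ^ (-(2 * γ)) * betaKernel γ ((x - s) / d) := by
      ext x
      obtain ⟨z, hz⟩ : ∃ z, z = (x - s) / d := ⟨_, rfl⟩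
      have h1 : x - s = d * z := by rw [hz]; field_simp
      have h2 : t - x = d * (1 - z) := by rw [mul_sub, ← h1, hd]; ring
      have h3 : d ^ (-(2 * γ)) = d ^ (-γ) * d ^ (-γ) := by
        rw [← Real.rpow_add hst]; ring_nf
      rw [← hz, h1, h2, posPow_mul hst, posPow_mul hst, betaKernel, h3]
      ring
    have hi := (integrable_betaKernel hγ).comp_div hst.ne'
    rw [hφ, MeasureTheory.integral_const_mul,
      integral_sub_right_eq_self (fun x => betaKernel γ (x / d)), Measure.integral_comp_div,
      abs_of_pos hst, posPow_of_pos hst, smul_eq_mul, ← mul_assoc, mul_comm _ (integral _ _)]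
    refine ⟨(hi.comp_sub_right s).const_mul _, ?_⟩
    congr 1
    nth_rewrite 2 [← Real.rpow_one d]
    rw [← Real.rpow_add hst]
    ring_nf

/-- The convolution of `g` with the truncated power `r₊^(-γ)`. -/
noncomputable def leftPotential (γ : ℝ) (g : ℝ → ℝ) (x : ℝ) : ℝ :=
  ∫ s, g s * posPow (-γ) (x - s)

/-- The correlation of `g` with the truncated power `r₊^(-γ)`. -/
noncomputable def rightPotential (γ : ℝ) (g : ℝ → ℝ) (x : ℝ) : ℝ :=
  ∫ t, g t * posPow (-γ) (t - x)

namespace BoundedOnUnit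

variable {g : ℝ → ℝ}

lemma leftPotential_of_nonpos (hg : BoundedOnUnit g) (γ : ℝ) {x : ℝ} (hx : x ≤ 0) :
    leftPotential γ g x = 0 := by
  refine integral_eq_zero_of_ae (.of_forall fun s => ?_)
  by_cases h : g s = 0
  · simp [h]
  · have := hg.mem_of_ne h
    simp [posPow_of_nonpos (a := -γ) (r := x - s) (by linarith [this.1])]

lemma rightPotential_of_one_le (hg : BoundedOnUnit g) (γ : ℝ) {x : ℝ} (hx : 1 ≤ x) :
    rightPotential γ g x = 0 := by
  refine integral_eq_zero_of_ae (.of_forall fun s => ?_)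
  by_cases h : g s = 0
  · simp [h]
  · have := hg.mem_of_ne h
    simp [posPow_of_nonpos (a := -γ) (r := s - x) (by linarith [this.2])]

lemma integrable_mul_posPow_sub (hg : BoundedOnUnit g) {γ x : ℝ} (hγ : γ < 1) (hx : x ≤ 1) :
    Integrable (fun s => g s * (posPow (1 - γ) (x - s) / (1 - γ))) := by
  refine hg.integrable_mul ?_
  refine Measure.integrableOn_of_bounded (M := 1 / (1 - γ)) (by simp)
    (Measurable.aestronglyMeasurable (by fun_prop)) ?_
  rw [ae_restrict_iff' measurableSet_Ioo]
  refine .of_forall fun s hs => ?_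
  rw [Real.norm_of_nonneg (div_nonneg (posPow_nonneg _ _) (by linarith))]
  refine div_le_div_of_nonneg_right ?_ (by linarith)
  rcases le_or_gt (x - s) 0 with h | h
  · rw [posPow_of_nonpos h]; exact zero_le_one
  · rw [posPow_of_pos h]
    exact Real.rpow_le_one h.le (by linarith [hs.1]) (by linarith)

lemma integral_leftPotential (hg : BoundedOnUnit g) {γ x : ℝ} (hγ : γ < 1)
    (hx : x ∈ Icc (0 : ℝ) 1) :
    IntegrableOn (leftPotential γ g) (Ioc 0 x) ∧
      ∫ y in (0 : ℝ)..x, leftPotential γ g y =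
        ∫ s, g s * (posPow (1 - γ) (x - s) / (1 - γ)) := by
  have hκ (s y : ℝ) : (Ioc 0 (x - s)).indicator (posPow (-γ)) (y - s) =
      if y ≤ x then posPow (-γ) (y - s) else 0 := by
    rcases le_or_gt (y - s) 0 with h | h
    · rw [posPow_of_nonpos h, ite_self, indicator_of_notMem fun h' => absurd h'.1 (not_lt.2 h)]
    · have hy : y - s ∈ Ioc 0 (x - s) ↔ y ≤ x :=
        ⟨fun h' => by linarith [h'.2], fun h' => ⟨h, by linarith⟩⟩
      simp only [indicator, hy]
  obtain ⟨hI, hE⟩ := integral_weight_mul_kernel (μ := (volume : Measure ℝ))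
    (ν := (volume : Measure ℝ)) (w := g)
    (ρ := fun s => posPow (1 - γ) (x - s) / (1 - γ))
    (κ := fun s y => (Ioc 0 (x - s)).indicator (posPow (-γ)) (y - s)) hg.measurable
    (by
      simp only [hκ]
      exact Measurable.ite (measurableSet_le measurable_snd measurable_const)
        (by fun_prop) measurable_const)
    (fun x y => indicator_nonneg (fun _ _ => posPow_nonneg _ _) _)
    (hg.integrable_mul_posPow_sub hγ hx.2)
    (fun s _ => by
      obtain ⟨h1, h2⟩ := integrable_posPow_head (a := -γ) (by linarith) (x - s)
      refine ⟨h1.comp_sub_right s, ?_⟩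
      rw [integral_sub_right_eq_self ((Ioc 0 (x - s)).indicator (posPow (-γ))), h2, neg_add_eq_sub])
  have hq (y : ℝ) : ∫ s, g s * (Ioc 0 (x - s)).indicator (posPow (-γ)) (y - s) =
      (Ioc 0 x).indicator (leftPotential γ g) y := by
    simp only [hκ]
    by_cases hy : y ≤ x
    · simp only [if_pos hy]
      rcases le_or_gt y 0 with h0 | h0
      · rw [indicator_of_notMem fun h' => absurd h'.1 (not_lt.2 h0)]
        exact hg.leftPotential_of_nonpos γ h0
      · rw [indicator_of_mem (mem_Ioc.2 ⟨h0, hy⟩), leftPotential]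
    · simp [hy]
  have hI' := hI.integral_prod_right
  simp only [hq] at hI' hE
  rw [integrable_indicator_iff measurableSet_Ioc] at hI'
  rw [MeasureTheory.integral_indicator measurableSet_Ioc] at hE
  rw [intervalIntegral.integral_of_le hx.1]
  exact ⟨hI', hE⟩

lemma integral_rpow_mul_primitive (hg : BoundedOnUnit g) {u : ℝ → ℝ}
    (hu : ∀ x ∈ Icc (0 : ℝ) 1, u x = ∫ s in (0 : ℝ)..x, g s) {γ x : ℝ} (hγ₀ : 0 < γ)
    (hγ : γ < 1) (hx : x ∈ Icc (0 : ℝ) 1) :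
    ∫ t in (0 : ℝ)..x, (x - t) ^ (-γ) * u t =
        ∫ s, g s * (posPow (1 - γ) (x - s) / (1 - γ)) := by
  have hκ (s t : ℝ) : (Ioc 0 (x - s)).indicator (posPow (-γ)) (x - t) =
      if s ≤ t then posPow (-γ) (x - t) else 0 := by
    rcases le_or_gt (x - t) 0 with h | h
    · rw [posPow_of_nonpos h, ite_self, indicator_of_notMem fun h' => absurd h'.1 (not_lt.2 h)]
    · have ht : x - t ∈ Ioc 0 (x - s) ↔ s ≤ t :=
        ⟨fun h' => by linarith [h'.2], fun h' => ⟨h, by linarith⟩⟩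
      simp only [indicator, ht]
  obtain ⟨hI, hE⟩ := integral_weight_mul_kernel (μ := (volume : Measure ℝ))
    (ν := (volume : Measure ℝ)) (w := g)
    (ρ := fun s => posPow (1 - γ) (x - s) / (1 - γ))
    (κ := fun s t => (Ioc 0 (x - s)).indicator (posPow (-γ)) (x - t)) hg.measurable
    (by
      simp only [hκ]
      exact Measurable.ite (measurableSet_le measurable_fst measurable_snd)
        (by fun_prop) measurable_const)
    (fun x y => indicator_nonneg (fun _ _ => posPow_nonneg _ _) _)
    (hg.integrable_mul_posPow_sub hγ hx.2)
    (fun s _ => by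
      obtain ⟨h1, h2⟩ := integrable_posPow_head (a := -γ) (by linarith) (x - s)
      refine ⟨h1.comp_sub_left x, ?_⟩
      rw [integral_sub_left_eq_self ((Ioc 0 (x - s)).indicator (posPow (-γ))), h2, neg_add_eq_sub])
  have hq (t : ℝ) : ∫ s, g s * (Ioc 0 (x - s)).indicator (posPow (-γ)) (x - t) =
      (Ioc 0 x).indicator (fun t => (x - t) ^ (-γ) * u t) t := by
    by_cases ht : t ∈ Ioc 0 x
    · rw [indicator_of_mem ht, hu t ⟨ht.1.le, ht.2.trans hx.2⟩,
        intervalIntegral.integral_of_le ht.1.le, ← MeasureTheory.integral_indicator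
        measurableSet_Ioc, ← MeasureTheory.integral_const_mul]
      refine integral_congr_ae (.of_forall fun s => ?_)
      have hp : posPow (-γ) (x - t) = (x - t) ^ (-γ) := by
        rcases ht.2.eq_or_lt with h | h
        · rw [h, sub_self, posPow_of_nonpos le_rfl, Real.zero_rpow (by linarith)]
        · exact posPow_of_pos (sub_pos.2 h)
      by_cases hs : g s = 0
      · simp [hs, indicator]
      · have hs := hg.mem_of_ne hs
        simp only [hκ]
        simp only [hp, indicator, mem_Ioc, hs.1, true_and]
        split_ifs <;> ring
    · rw [indicator_of_notMem ht]
      refine integral_eq_zero_of_ae (.of_forall fun s => ?_)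
      by_cases hs : g s = 0
      · simp [hs]
      · have hs := hg.mem_of_ne hs
        simp only [hκ, Pi.zero_apply]
        split_ifs with h
        · rw [posPow_of_nonpos, mul_zero]
          by_contra h'
          exact ht ⟨hs.1.trans_le h, by linarith⟩
        · rw [mul_zero]
  simp only [hq] at hE
  rw [intervalIntegral.integral_of_le hx.1, ← hE,
    MeasureTheory.integral_indicator measurableSet_Ioc]

lemma rlLeft_ae_eq (hg : BoundedOnUnit g) {u : ℝ → ℝ}
    (hu : ∀ x ∈ Icc (0 : ℝ) 1, u x = ∫ s in (0 : ℝ)..x, g s) {γ : ℝ} (hγ₀ : 0 < γ)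
    (hγ : γ < 1) :
    ∀ᵐ x, x ∈ Ioo (0 : ℝ) 1 →
      rlLeft γ u x = 1 / Real.Gamma (1 - γ) * leftPotential γ g x := by
  have hint := (intervalIntegrable_iff_integrableOn_Ioc_of_le zero_le_one).2
    (hg.integral_leftPotential hγ (right_mem_Icc.2 zero_le_one)).1
  filter_upwards [hint.ae_hasDerivAt_integral] with x hx hx01
  have hd := hx (by rw [uIcc_of_le zero_le_one]; exact Ioo_subset_Icc_self hx01) 0 (by simp)
  refine HasDerivAt.deriv ((hd.congr_of_eventuallyEq ?_).const_mul _)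
  filter_upwards [isOpen_Ioo.mem_nhds hx01] with y hy
  have hy := Ioo_subset_Icc_self hy
  rw [hg.integral_rpow_mul_primitive hu hγ₀ hγ hy, (hg.integral_leftPotential hγ hy).2]

lemma reflect (hg : BoundedOnUnit g) : BoundedOnUnit fun s => -g (1 - s) where
  measurable := (hg.measurable.comp (measurable_const.sub measurable_id)).neg
  eq_zero x hx := by
    rw [hg.eq_zero, neg_zero]
    exact fun h => hx ⟨by linarith [h.2], by linarith [h.1]⟩
  bounded := hg.bounded.imp fun M hM x => by simpa using hM (1 - x)

end BoundedOnUnit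

lemma rlRight_eq_rlLeft_reflect (γ : ℝ) (u : ℝ → ℝ) (x : ℝ) :
    rlRight γ u x = rlLeft γ (fun t => u (1 - t)) (1 - x) := by
  have h : (fun x => -(1 / Real.Gamma (1 - γ)) * ∫ t in x..(1 : ℝ), (t - x) ^ (-γ) * u t) =
      fun x => -((fun y => (1 / Real.Gamma (1 - γ)) *
        ∫ t in (0 : ℝ)..y, (y - t) ^ (-γ) * u (1 - t)) (1 - x)) := by
    ext x
    have := intervalIntegral.integral_comp_sub_left (a := 0) (b := 1 - x)
      (fun t => (t - x) ^ (-γ) * u t) 1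
    simp only [sub_sub_cancel, sub_zero] at this
    rw [← this, neg_mul]
    simp only [sub_right_comm]
  rw [rlRight, h, deriv.fun_neg, neg_eq_iff_eq_neg]
  exact deriv_comp_const_sub (fun y => (1 / Real.Gamma (1 - γ)) *
    ∫ t in (0 : ℝ)..y, (y - t) ^ (-γ) * u (1 - t)) 1 x

lemma BoundedOnUnit.rlRight_ae_eq {g : ℝ → ℝ} (hg : BoundedOnUnit g) {u : ℝ → ℝ}
    (hu : ∀ x ∈ Icc (0 : ℝ) 1, u x = ∫ s in (0 : ℝ)..x, g s) (hu₁ : u 1 = 0) {γ : ℝ}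
    (hγ₀ : 0 < γ) (hγ : γ < 1) :
    ∀ᵐ x, x ∈ Ioo (0 : ℝ) 1 →
      rlRight γ u x = -(1 / Real.Gamma (1 - γ) * rightPotential γ g x) := by
  have hu' : ∀ x ∈ Icc (0 : ℝ) 1, u (1 - x) = ∫ s in (0 : ℝ)..x, -g (1 - s) := by
    intro x hx
    have h1 := hu 1 (right_mem_Icc.2 zero_le_one)
    rw [hu (1 - x) ⟨by linarith [hx.2], by linarith [hx.1]⟩, intervalIntegral.integral_neg,
      intervalIntegral.integral_comp_sub_left (fun s => g s), sub_zero]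
    have := intervalIntegral.integral_add_adjacent_intervals
      (hg.integrable.intervalIntegrable (a := 0) (b := 1 - x))
      (hg.integrable.intervalIntegrable (a := 1 - x) (b := 1))
    linarith
  have h := hg.reflect.rlLeft_ae_eq hu' hγ₀ hγ
  filter_upwards [(Measure.measurePreserving_sub_left volume (1 : ℝ)).quasiMeasurePreserving.ae h]
    with x hx hx01
  rw [rlRight_eq_rlLeft_reflect, hx ⟨by linarith [hx01.2], by linarith [hx01.1]⟩, ← mul_neg]
  congr 1
  rw [leftPotential, rightPotential, ← MeasureTheory.integral_neg,
    ← integral_sub_left_eq_self (fun t => -(g t * posPow (-γ) (t - x))) volume 1]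
  simp only [neg_mul, sub_right_comm]

/-- The energy of `g` for the one-sided kernel `(t - s)₊^(1 - 2γ)`. -/
noncomputable def rieszEnergy (γ : ℝ) (g : ℝ → ℝ) : ℝ :=
  ∫ p : ℝ × ℝ, g p.1 * g p.2 * posPow (1 - 2 * γ) (p.2 - p.1)

/-- The one-sided Gagliardo density of a primitive of `g`. -/
noncomputable def gagliardoDensity (γ : ℝ) (g : ℝ → ℝ) (q : ℝ × ℝ) : ℝ :=
  posPow (-(1 + 2 * γ)) (q.2 - q.1) * (∫ s in Ioo q.1 q.2, g s) ^ 2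

lemma gagliardoDensity_nonneg (γ : ℝ) (g : ℝ → ℝ) (q : ℝ × ℝ) : 0 ≤ gagliardoDensity γ g q :=
  mul_nonneg (posPow_nonneg _ _) (sq_nonneg _)

lemma gagliardoDensity_of_le (γ : ℝ) (g : ℝ → ℝ) {x y : ℝ} (hxy : y ≤ x) :
    gagliardoDensity γ g (x, y) = 0 := by
  rw [gagliardoDensity, posPow_of_nonpos (sub_nonpos.2 hxy), zero_mul]

namespace BoundedOnUnit

variable {g : ℝ → ℝ}

lemma integral_leftPotential_mul_rightPotential (hg : BoundedOnUnit g) {γ : ℝ} (hγ : γ < 1) :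
    ∫ x, leftPotential γ g x * rightPotential γ g x = (∫ z, betaKernel γ z) * rieszEnergy γ g := by
  obtain ⟨-, hE⟩ := integral_weight_mul_kernel (μ := (volume : Measure (ℝ × ℝ)))
    (ν := (volume : Measure ℝ)) (w := fun p : ℝ × ℝ => g p.1 * g p.2)
    (ρ := fun p => (∫ z, betaKernel γ z) * posPow (1 - 2 * γ) (p.2 - p.1))
    (κ := fun p x => posPow (-γ) (x - p.1) * posPow (-γ) (p.2 - x))
    ((hg.measurable.comp measurable_fst).mul (hg.measurable.comp measurable_snd))
    (by unfold Function.uncurry; fun_prop)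
    (fun p x => mul_nonneg (posPow_nonneg _ _) (posPow_nonneg _ _))
    (((hg.integrable_mul_mul_posPow (a := 1 - 2 * γ) (by linarith)).const_mul
      (∫ z, betaKernel γ z)).congr (.of_forall fun p => by ring))
    (fun p _ => integrable_posPow_mul_posPow hγ p.1 p.2)
  rw [rieszEnergy, ← MeasureTheory.integral_const_mul]
  have h1 (x : ℝ) : ∫ p : ℝ × ℝ, g p.1 * g p.2 * (posPow (-γ) (x - p.1) * posPow (-γ) (p.2 - x)) =
      leftPotential γ g x * rightPotential γ g x := by
    rw [leftPotential, rightPotential, ← integral_prod_mul, ← Measure.volume_eq_prod]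
    simp only [mul_mul_mul_comm]
  simp only [h1] at hE
  rw [hE]
  simp only [mul_left_comm]

lemma integral_gagliardoDensity (hg : BoundedOnUnit g) {γ : ℝ} (hγ₁ : 1 / 2 < γ) (hγ₂ : γ < 1) :
    Integrable (gagliardoDensity γ g) ∧
      ∫ q, gagliardoDensity γ g q = rieszEnergy γ g / (γ * (2 * γ - 1)) := by
  set a := -(1 + 2 * γ) with ha
  have hsec (p : ℝ × ℝ) :
      Integrable (fun q : ℝ × ℝ =>
        if q.1 < p.1 ∧ p.1 < p.2 ∧ p.2 < q.2 then posPow a (q.2 - q.1) else 0) ∧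
      ∫ q : ℝ × ℝ, (if q.1 < p.1 ∧ p.1 < p.2 ∧ p.2 < q.2 then posPow a (q.2 - q.1) else 0) =
        posPow (1 - 2 * γ) (p.2 - p.1) / (2 * γ * (2 * γ - 1)) := by
    by_cases hp : p.1 < p.2
    · simp only [hp, true_and]
      obtain ⟨h1, h2⟩ := integrable_slab_kernel (a := a) (by linarith) hp
      refine ⟨h1, h2.trans ?_⟩
      rw [posPow_of_pos (sub_pos.2 hp), ha]
      ring_nf
    · simp [hp, posPow_of_nonpos (sub_nonpos.2 (not_lt.1 hp))]
  obtain ⟨hI, hE⟩ := integral_weight_mul_kernel (μ := (volume : Measure (ℝ × ℝ)))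
    (ν := (volume : Measure (ℝ × ℝ))) (w := fun p : ℝ × ℝ => g p.1 * g p.2)
    (ρ := fun p => posPow (1 - 2 * γ) (p.2 - p.1) / (2 * γ * (2 * γ - 1)))
    (κ := fun p q => if q.1 < p.1 ∧ p.1 < p.2 ∧ p.2 < q.2 then posPow a (q.2 - q.1) else 0)
    ((hg.measurable.comp measurable_fst).mul (hg.measurable.comp measurable_snd))
    (by
      refine Measurable.ite ?_ (by fun_prop) measurable_const
      measurability)
    (fun p q => by
      split_ifs
      · exact posPow_nonneg _ _
      · exact le_rfl)
    (((hg.integrable_mul_mul_posPow (a := 1 - 2 * γ) (by linarith)).div_const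
      (2 * γ * (2 * γ - 1))).congr (.of_forall fun p => by ring))
    (fun p _ => hsec p)
  have h1 (q : ℝ × ℝ) : ∫ p : ℝ × ℝ, g p.1 * g p.2 *
      (if q.1 < p.1 ∧ p.1 < p.2 ∧ p.2 < q.2 then posPow a (q.2 - q.1) else 0) =
      gagliardoDensity γ g q / 2 := by
    have h2 := two_mul_integral_mul_of_lt
      (hg.integrable.indicator (measurableSet_Ioo (a := q.1) (b := q.2)))
    rw [gagliardoDensity, ← MeasureTheory.integral_indicator measurableSet_Ioo, ← h2,
      mul_div_assoc, mul_div_cancel_left₀ _ two_ne_zero, ← MeasureTheory.integral_const_mul]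
    refine integral_congr_ae (.of_forall fun p => ?_)
    simp only [indicator, mem_ofPred_eq, mem_Ioo]
    by_cases hp : p.1 < p.2
    · by_cases h3 : q.1 < p.1
      · by_cases h4 : p.2 < q.2
        · simp [hp, h3, h4, hp.trans h4, h3.trans hp, ha, mul_comm]
        · simp [h4]
      · simp [h3]
    · simp [hp]
  have hI' := hI.integral_prod_right
  simp only [h1] at hI' hE
  refine ⟨(hI'.mul_const 2).congr (.of_forall fun q => by ring), ?_⟩
  rw [MeasureTheory.integral_div] at hE
  have h3 : ∫ p : ℝ × ℝ, g p.1 * g p.2 *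
      (posPow (1 - 2 * γ) (p.2 - p.1) / (2 * γ * (2 * γ - 1))) =
      rieszEnergy γ g / (2 * γ * (2 * γ - 1)) := by
    simp only [rieszEnergy, ← mul_div_assoc, MeasureTheory.integral_div]
  rw [h3, div_eq_iff two_ne_zero] at hE
  rw [hE]
  have : 2 * γ - 1 ≠ 0 := by linarith
  have : γ ≠ 0 := by linarith
  field_simp

lemma gagliardoDensity_of_lt (hg : BoundedOnUnit g) {u : ℝ → ℝ}
    (hu : ∀ x ∈ Icc (0 : ℝ) 1, u x = ∫ s in (0 : ℝ)..x, g s) (γ : ℝ) {x y : ℝ}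
    (hx : x ∈ Ioo (0 : ℝ) 1) (hy : y ∈ Ioo (0 : ℝ) 1) (hxy : x < y) :
    gagliardoDensity γ g (x, y) = (u x - u y) ^ 2 / |x - y| ^ (1 + 2 * γ) := by
  have h := intervalIntegral.integral_add_adjacent_intervals
    (hg.integrable.intervalIntegrable (a := 0) (b := x))
    (hg.integrable.intervalIntegrable (a := x) (b := y))
  rw [← hu x (Ioo_subset_Icc_self hx), ← hu y (Ioo_subset_Icc_self hy),
    intervalIntegral.integral_of_le hxy.le, integral_Ioc_eq_integral_Ioo] at h
  have h' : ∫ s in Ioo x y, g s = u y - u x := by linarith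
  rw [gagliardoDensity]
  simp only
  rw [h', posPow_of_pos (sub_pos.2 hxy), Real.rpow_neg (sub_nonneg.2 hxy.le), abs_sub_comm,
    abs_of_pos (sub_pos.2 hxy), div_eq_inv_mul, sub_sq_comm]

lemma gagliardoSeminorm_le (hg : BoundedOnUnit g) {u : ℝ → ℝ}
    (hu : ∀ x ∈ Icc (0 : ℝ) 1, u x = ∫ s in (0 : ℝ)..x, g s) {γ : ℝ}
    (hγ₁ : 1 / 2 < γ) (hγ₂ : γ < 1) :
    (∫ x in Ioo (0 : ℝ) 1, ∫ y in Ioo (0 : ℝ) 1, (u x - u y) ^ 2 / |x - y| ^ (1 + 2 * γ)) ≤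
      2 * (rieszEnergy γ g / (γ * (2 * γ - 1))) := by
  obtain ⟨hI, hE⟩ := hg.integral_gagliardoDensity hγ₁ hγ₂
  set T : ℝ × ℝ → ℝ := fun q => gagliardoDensity γ g q + gagliardoDensity γ g q.swap with hT
  have hS : Integrable fun q : ℝ × ℝ => gagliardoDensity γ g q.swap := Integrable.swap hI
  have hTI : Integrable T := hI.add hS
  have hTE : ∫ q, T q = 2 * (rieszEnergy γ g / (γ * (2 * γ - 1))) := by
    rw [MeasureTheory.integral_add hI hS, ← hE, Measure.volume_eq_prod,
      integral_prod_swap, two_mul]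
  have heq : ∀ x ∈ Ioo (0 : ℝ) 1, ∀ y ∈ Ioo (0 : ℝ) 1,
      (u x - u y) ^ 2 / |x - y| ^ (1 + 2 * γ) = T (x, y) := by
    intro x hx y hy
    simp only [hT, Prod.swap_prod_mk]
    rcases lt_trichotomy x y with h | h | h
    · rw [hg.gagliardoDensity_of_lt hu γ hx hy h, gagliardoDensity_of_le γ g h.le, add_zero]
    · simp [h, gagliardoDensity_of_le γ g (le_refl y)]
    · rw [hg.gagliardoDensity_of_lt hu γ hy hx h, gagliardoDensity_of_le γ g h.le, zero_add,
        abs_sub_comm, sub_sq_comm]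
  calc _ = ∫ x in Ioo (0 : ℝ) 1, ∫ y in Ioo (0 : ℝ) 1, T (x, y) :=
        setIntegral_congr_fun measurableSet_Ioo fun x hx =>
          setIntegral_congr_fun measurableSet_Ioo fun y hy => heq x hx y hy
    _ = ∫ q in Ioo (0 : ℝ) 1 ×ˢ Ioo (0 : ℝ) 1, T q :=
        (setIntegral_prod T hTI.integrableOn).symm
    _ ≤ ∫ q, T q := setIntegral_le_integral hTI (.of_forall fun q =>
        add_nonneg (gagliardoDensity_nonneg _ _ _) (gagliardoDensity_nonneg _ _ _))
    _ = _ := hTE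

lemma integral_rlLeft_mul_rlRight (hg : BoundedOnUnit g) {u : ℝ → ℝ}
    (hu : ∀ x ∈ Icc (0 : ℝ) 1, u x = ∫ s in (0 : ℝ)..x, g s) (hu₁ : u 1 = 0) {γ : ℝ}
    (hγ₀ : 0 < γ) (hγ : γ < 1) :
    ∫ x in Ioo (0 : ℝ) 1, rlLeft γ u x * rlRight γ u x =
      -((1 / Real.Gamma (1 - γ)) ^ 2 * (∫ z, betaKernel γ z) * rieszEnergy γ g) := by
  have h : ∫ x in Ioo (0 : ℝ) 1, rlLeft γ u x * rlRight γ u x =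
      ∫ x in Ioo (0 : ℝ) 1, -(1 / Real.Gamma (1 - γ)) ^ 2 *
        (leftPotential γ g x * rightPotential γ g x) := by
    refine setIntegral_congr_ae measurableSet_Ioo ?_
    filter_upwards [hg.rlLeft_ae_eq hu hγ₀ hγ, hg.rlRight_ae_eq hu hu₁ hγ₀ hγ] with x h1 h2 hx
    rw [h1 hx, h2 hx]
    ring
  rw [h, MeasureTheory.integral_const_mul, setIntegral_eq_integral_of_forall_compl_eq_zero,
    hg.integral_leftPotential_mul_rightPotential hγ]
  · ring
  · intro x hx
    rcases le_or_gt x 0 with h0 | h0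
    · rw [hg.leftPotential_of_nonpos γ h0, zero_mul]
    · rw [hg.rightPotential_of_one_le γ (not_lt.1 fun h1 => hx ⟨h0, h1⟩), mul_zero]

end BoundedOnUnit

lemma exists_boundedOnUnit_primitive {u u' : ℝ → ℝ}
    (hu : ∀ x ∈ Icc (0 : ℝ) 1, HasDerivWithinAt u (u' x) (Icc 0 1) x)
    (hu' : ContinuousOn u' (Icc 0 1)) (h0 : u 0 = 0) :
    ∃ g, BoundedOnUnit g ∧ ∀ x ∈ Icc (0 : ℝ) 1, u x = ∫ s in (0 : ℝ)..x, g s := by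
  classical
  refine ⟨(Ioo 0 1).indicator u', ⟨?_, fun x hx => indicator_of_notMem hx _, ?_⟩, ?_⟩
  · rw [← piecewise_eq_indicator]
    exact (hu'.mono Ioo_subset_Icc_self).measurable_piecewise continuousOn_const measurableSet_Ioo
  · obtain ⟨M, hM⟩ := isCompact_Icc.exists_bound_of_continuousOn hu'
    refine ⟨max M 0, fun x => ?_⟩
    by_cases hx : x ∈ Ioo (0 : ℝ) 1
    · rw [indicator_of_mem hx]
      exact (hM x (Ioo_subset_Icc_self hx)).trans (le_max_left _ _)
    · simp [hx]
  · intro x hx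
    have hsub : Icc 0 x ⊆ Icc (0 : ℝ) 1 := Icc_subset_Icc_right hx.2
    have h := intervalIntegral.integral_eq_sub_of_hasDerivAt_of_le hx.1
      (fun y hy => (hu y (hsub hy)).continuousWithinAt.mono hsub)
      (fun y hy => (hu y (hsub (Ioo_subset_Icc_self hy))).hasDerivAt
        (Icc_mem_nhds hy.1 (hy.2.trans_le hx.2)))
      ((hu'.mono hsub).intervalIntegrable_of_Icc hx.1)
    rw [h0, sub_zero] at h
    rw [← h, intervalIntegral.integral_of_le hx.1, intervalIntegral.integral_of_le hx.1,
      integral_Ioc_eq_integral_Ioo, integral_Ioc_eq_integral_Ioo]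
    refine setIntegral_congr_fun measurableSet_Ioo fun y hy => ?_
    rw [indicator_of_mem (mem_Ioo.2 ⟨hy.1, hy.2.trans_le hx.2⟩)]

theorem stmt_9 (γ : ℝ) (hγ₁ : 1/2 < γ) (hγ₂ : γ < 1) :
    ∃ C > (0:ℝ), ∀ u u' : ℝ → ℝ,
      -- `u ∈ C¹([0,1])` with derivative `u'` on `[0,1]` ...
      (∀ x ∈ Set.Icc (0:ℝ) 1, HasDerivWithinAt u (u' x) (Set.Icc 0 1) x) →
      ContinuousOn u' (Set.Icc 0 1) →
      u 0 = 0 → u 1 = 0 →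
      (∫ x in Set.Ioo (0:ℝ) 1, ∫ y in Set.Ioo (0:ℝ) 1,
          (u x - u y) ^ 2 / |x - y| ^ (1 + 2 * γ))
        ≤ C * |∫ x in Set.Ioo (0:ℝ) 1, rlLeft γ u x * rlRight γ u x| := by
  have hB := integral_betaKernel_pos hγ₂
  have hΓ : 0 < Real.Gamma (1 - γ) := Real.Gamma_pos_of_pos (by linarith)
  have hγ₀ : 0 < γ := by linarith
  have hγ₃ : 0 < 2 * γ - 1 := by linarith
  set K := (1 / Real.Gamma (1 - γ)) ^ 2 * ∫ z, betaKernel γ z with hK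
  have hK₀ : 0 < K := by positivity
  refine ⟨2 / (γ * (2 * γ - 1) * K), by positivity, fun u u' hu hu' h0 h1 => ?_⟩
  obtain ⟨g, hg, hgu⟩ := exists_boundedOnUnit_primitive hu hu' h0
  rw [hg.integral_rlLeft_mul_rlRight hgu h1 hγ₀ hγ₂, ← hK, abs_neg, abs_mul, abs_of_pos hK₀]
  calc _ ≤ 2 * (rieszEnergy γ g / (γ * (2 * γ - 1))) :=
        hg.gagliardoSeminorm_le hgu hγ₁ hγ₂
    _ ≤ 2 * (|rieszEnergy γ g| / (γ * (2 * γ - 1))) := by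
        gcongr
        exact le_abs_self _
    _ = _ := by field_simp
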